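/- arXiv:2304.05005 — 4 statements merged into one kernel-verified Lean document; each statement's English description precedes it below -/
import Mathlib

section
/- A type-wise distribution π ∈ Δ(A)^Θ is strategy-representable if and only if π is a finite mixture of type-wise product distributions, i.e., there exist a positive integer T, weights σ' ∈ Δ({1,…,T}), and type-wise product distributions π^1,…,π^T ∈ Δ(A)^Θ such that π(θ;a) = ∑_{t=1}^T σ'(t)·π^t(θ;a) for every θ ∈ Θ and a ∈ A. -/
open Finset
open scoped Classical

noncomputable section

/-- `f` is a probability distribution on the finite set `X`. -/
def IsDist {X : Type*} [Fintype X] (f : X → ℝ) : Prop :=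
  (∀ x, f x ∈ Set.Icc (0 : ℝ) 1) ∧ ∑ x, f x = 1

variable {ι : Type*} [Fintype ι] [Nonempty ι]
  {Θ A : ι → Type*}
  [∀ i, Fintype (Θ i)] [∀ i, Nonempty (Θ i)]
  [∀ i, Fintype (A i)] [∀ i, Nonempty (A i)]

/-- The map `η : Δ(S) → Δ(A)^Θ` : `η(σ)(θ;a) = ∑_{s : s(θ) = a} σ(s)`. -/
def eta (σ : ((i : ι) → Θ i → A i) → ℝ) :
    ((i : ι) → Θ i) → ((i : ι) → A i) → ℝ :=
  fun θ a => ∑ s : (i : ι) → Θ i → A i, if (fun i => s i (θ i)) = a then σ s else 0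

/-- `π` is strategy-representable if it is realized by a distribution over strategy profiles. -/
def StrategyRepresentable (π : ((i : ι) → Θ i) → ((i : ι) → A i) → ℝ) : Prop :=
  ∃ σ : ((i : ι) → Θ i → A i) → ℝ, IsDist σ ∧ eta σ = π

/-- `π` is a type-wise product distribution. -/
def TypewiseProduct (π : ((i : ι) → Θ i) → ((i : ι) → A i) → ℝ) : Prop :=
  ∃ p : (i : ι) → Θ i → A i → ℝ,
    (∀ i θi, IsDist (p i θi)) ∧ ∀ θ a, π θ a = ∏ i, p i (θ i) (a i)

lemma IsDist.of_nonneg {X : Type*} [Fintype X] {f : X → ℝ} (h0 : ∀ x, 0 ≤ f x)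
    (h1 : ∑ x, f x = 1) : IsDist f :=
  ⟨fun x => ⟨h0 x, h1 ▸ single_le_sum (fun y _ => h0 y) (mem_univ x)⟩, h1⟩

lemma isDist_indicator {X : Type*} [Fintype X] (x : X) :
    IsDist fun y => if x = y then (1 : ℝ) else 0 :=
  .of_nonneg (fun y => by positivity) (by simp)

lemma IsDist.mixture {X Y : Type*} [Fintype X] [Fintype Y] {w : X → ℝ} {f : X → Y → ℝ}
    (hw : IsDist w) (hf : ∀ x, IsDist (f x)) : IsDist fun y => ∑ x, w x * f x y := by
  refine .of_nonneg (fun y => sum_nonneg fun x _ => mul_nonneg (hw.1 x).1 ((hf x).1 y).1) ?_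
  rw [sum_comm]
  simp [← mul_sum, (hf _).2, hw.2]

/-- The product of finitely many distributions is a distribution. -/
lemma IsDist.pi {κ : Type*} [Fintype κ] {X : κ → Type*} [∀ k, Fintype (X k)]
    {f : (k : κ) → X k → ℝ} (hf : ∀ k, IsDist (f k)) :
    IsDist fun x : (k : κ) → X k => ∏ k, f k (x k) := by
  refine .of_nonneg (fun x => prod_nonneg fun k _ => ((hf k).1 _).1) ?_
  rw [← Fintype.prod_sum]
  simp [(hf _).2]

/-- The marginal of a product distribution at a coordinate is the corresponding factor. -/
lemma sum_prod_ite_apply_eq {κ X : Type*} [Fintype κ] [Fintype X]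
    {f : κ → X → ℝ} (hf : ∀ k, IsDist (f k)) (k₀ : κ) (x₀ : X) :
    ∑ x : κ → X, (if x k₀ = x₀ then ∏ k, f k (x k) else 0) = f k₀ x₀ := by
  have h (x : κ → X) : (if x k₀ = x₀ then ∏ k, f k (x k) else 0) =
      ∏ k, f k (x k) * if k = k₀ then (if x k = x₀ then 1 else 0) else 1 := by
    rw [prod_mul_distrib]
    simp
  simp_rw [h]
  rw [← Fintype.prod_sum (fun k y => f k y * if k = k₀ then (if y = x₀ then 1 else 0) else 1),
    prod_eq_single k₀ _ (by simp)]
  · simp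
  · intro k _ hk
    simp [hk, (hf k).2]

/-- Drawing every action of every type independently realizes the type-wise product
distribution. -/
lemma eta_prod {ι : Type*} [Fintype ι] {Θ A : ι → Type*}
    [∀ i, Fintype (Θ i)] [∀ i, Fintype (A i)]
    {p : (i : ι) → Θ i → A i → ℝ} (hp : ∀ i θi, IsDist (p i θi))
    (θ : (i : ι) → Θ i) (a : (i : ι) → A i) :
    eta (fun s => ∏ i, ∏ t, p i t (s i t)) θ a = ∏ i, p i (θ i) (a i) := by
  have h (s : (i : ι) → Θ i → A i) :
      (if (fun i => s i (θ i)) = a then ∏ i, ∏ t, p i t (s i t) else 0) =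
        ∏ i, if s i (θ i) = a i then ∏ t, p i t (s i t) else 0 := by
    simp [prod_ite_zero, funext_iff]
  simp_rw [eta, h]
  rw [← Fintype.prod_sum fun i (r : Θ i → A i) =>
    if r (θ i) = a i then ∏ t, p i t (r t) else 0]
  exact prod_congr rfl fun i _ => sum_prod_ite_apply_eq (hp i) (θ i) (a i)

lemma eta_mixture {ι : Type*} [Fintype ι] {Θ A : ι → Type*}
    [∀ i, Fintype (Θ i)] [∀ i, Fintype (A i)]
    {X : Type*} [Fintype X] (w : X → ℝ)
    (σ : X → ((i : ι) → Θ i → A i) → ℝ) (θ : (i : ι) → Θ i) (a : (i : ι) → A i) :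
    eta (fun s => ∑ x, w x * σ x s) θ a = ∑ x, w x * eta (σ x) θ a := by
  simp_rw [eta, mul_sum, mul_ite, mul_zero]
  rw [sum_comm]
  exact sum_congr rfl fun s _ => by split_ifs <;> simp

lemma typewiseProduct_pure {ι : Type*} [Fintype ι] {Θ A : ι → Type*}
    [∀ i, Fintype (A i)] (s : (i : ι) → Θ i → A i) :
    TypewiseProduct fun θ a => if (fun i => s i (θ i)) = a then 1 else 0 :=
  ⟨fun i θi x => if s i θi = x then 1 else 0, fun i θi => isDist_indicator (s i θi),
    fun θ a => by simp [prod_ite_zero, funext_iff]⟩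

/-- A type-wise distribution is strategy-representable iff it is a finite mixture of
type-wise product distributions. -/
theorem strategyRepresentable_iff_finite_mixture
    (π : ((i : ι) → Θ i) → ((i : ι) → A i) → ℝ)
    (hπ : ∀ θ, IsDist (π θ)) :
    StrategyRepresentable π ↔
      ∃ T : ℕ, 0 < T ∧
        ∃ (w : Fin T → ℝ) (πs : Fin T → ((i : ι) → Θ i) → ((i : ι) → A i) → ℝ),
          IsDist w ∧ (∀ t, TypewiseProduct (πs t)) ∧
          ∀ θ a, π θ a = ∑ t, w t * πs t θ a := by
  constructor
  · rintro ⟨σ, hσ, rfl⟩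
    let e := (Fintype.equivFin ((i : ι) → Θ i → A i)).symm
    refine ⟨_, Fintype.card_pos, fun t => σ (e t),
      fun t θ a => if (fun i => e t i (θ i)) = a then 1 else 0,
      ⟨fun t => hσ.1 _, (e.sum_comp σ).trans hσ.2⟩, fun t => typewiseProduct_pure (e t),
      fun θ a => ?_⟩
    rw [e.sum_comp fun s => σ s * if (fun i => s i (θ i)) = a then 1 else 0]
    simp [eta]
  · rintro ⟨T, -, w, πs, hw, hπs, hmix⟩
    choose p hp hprod using hπs
    refine ⟨fun s => ∑ t, w t * ∏ i, ∏ θi, p t i θi (s i θi),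
      hw.mixture fun t => IsDist.pi fun i => IsDist.pi (hp t i), ?_⟩
    funext θ a
    rw [eta_mixture, hmix]
    exact sum_congr rfl fun t _ => by rw [eta_prod (hp t), hprod]
end
end

section
/- Let T ≥ 1 and, for each player i ∈ N and round t ∈ {1,…,T}, let π_i^t ∈ Δ(A_i)^{Θ_i}. Define reward vectors u_i^t ∈ [0,1]^{Θ_i × A_i} by u_i^t(θ_i,a_i) = E_{θ_{-i}∼ρ|θ_i}[ ∑_{a_{-i}} (∏_{j≠i} π_j^t(θ_j;a_j)) · v_i(θ; a_i, a_{-i}) ]. Then the empirical distribution σ ∈ Δ(S) defined by σ(s) = (1/T)·∑_{t=1}^T ∏_{i∈N} ∏_{θ_i∈Θ_i} π_i^t(θ_i; s_i(θ_i)) is an ε-approximate agent-normal-form correlated equilibrium with ε = (max_{i∈N} R_TS,i)/T, where R_TS,i is the type-wise swap regret of the sequence (π_i^t)_{t=1}^T with respect to the rewards (u_i^t)_{t=1}^T and prior ρ_i. -/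
open Finset
open scoped Classical

noncomputable section

variable {ι : Type*} [Fintype ι] [Nonempty ι]
  {Θ A : ι → Type*}
  [∀ i, Fintype (Θ i)] [∀ i, Nonempty (Θ i)]
  [∀ i, Fintype (A i)] [∀ i, Nonempty (A i)]

/-- The marginal `ρ_i(θ_i)` of the prior `ρ` for player `i`. -/
def marginal (ρ : ((i : ι) → Θ i) → ℝ) (i : ι) (θi : Θ i) : ℝ :=
  ∑ θ : (j : ι) → Θ j, if θ i = θi then ρ θ else 0

/-- ε-approximate agent-normal-form correlated equilibrium (incentive constraints). -/
def IsANFCE (ρ : ((i : ι) → Θ i) → ℝ)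
    (v : (i : ι) → ((j : ι) → Θ j) → ((j : ι) → A j) → ℝ) (ε : ℝ)
    (σ : ((i : ι) → Θ i → A i) → ℝ) : Prop :=
  ∀ (i : ι) (φ : Θ i → A i → A i),
    ∑ θ, ρ θ * ∑ s : (j : ι) → Θ j → A j, σ s * v i θ (fun j => s j (θ j)) ≥
      ∑ θ, ρ θ * ∑ s : (j : ι) → Θ j → A j,
        σ s * v i θ (Function.update (fun j => s j (θ j)) i (φ (θ i) (s i (θ i)))) - ε

/-- The type-wise swap regret of player `i` for decisions `πt i` and rewards `u i`
with respect to the prior marginals of `ρ`. -/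
def typewiseSwapRegret (ρ : ((i : ι) → Θ i) → ℝ) (T : ℕ)
    (πt : (i : ι) → Fin T → Θ i → A i → ℝ)
    (u : (i : ι) → Fin T → Θ i → A i → ℝ) (i : ι) : ℝ :=
  ⨆ φ : Θ i → A i → A i,
    ∑ t, ∑ θi, marginal ρ i θi *
      ∑ ai, πt i t θi ai * (u i t θi (φ θi ai) - u i t θi ai)

/-- A product distribution on a dependent product has total mass the product of the masses. -/
theorem sum_pi_prod {κ : Type*} [Fintype κ] {B : κ → Type*} [∀ k, Fintype (B k)]
    (p : (k : κ) → B k → ℝ) :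
    ∑ g : (k : κ) → B k, ∏ k, p k (g k) = ∏ k, ∑ b, p k b := by
  rw [Finset.prod_univ_sum, Fintype.piFinset_univ]

/-- The coordinate marginals of a product distribution are its factors. -/
theorem sum_pi_prod_mul_ite {Γ B : Type*} [Fintype Γ] [Fintype B]
    (p : Γ → B → ℝ) (hp : ∀ c, ∑ b, p c b = 1) (c₀ : Γ) (b₀ : B) :
    ∑ g : Γ → B, (∏ c, p c (g c)) * (if g c₀ = b₀ then 1 else 0) = p c₀ b₀ := by
  have key : ∀ g : Γ → B, (∏ c, p c (g c)) * (if g c₀ = b₀ then (1 : ℝ) else 0) =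
      ∏ c, p c (g c) * (if c = c₀ then (if g c = b₀ then 1 else 0) else 1) := by
    intro g
    rw [Finset.prod_mul_distrib, Finset.prod_ite_eq' Finset.univ c₀
      (fun c => if g c = b₀ then (1 : ℝ) else 0)]
    simp
  rw [Finset.sum_congr rfl fun g _ => key g,
    sum_pi_prod fun c b => p c b * (if c = c₀ then (if b = b₀ then 1 else 0) else 1),
    Finset.prod_eq_single c₀]
  · simp
  · intro c _ hc
    simp [hc, hp]
  · simp

/-- Drawing every agent's action independently and then evaluating at a type profile `θ` amounts to
drawing actions independently from the distributions of the agents `θ j`. -/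
theorem sum_strategy_eval
    (p : (i : ι) → Θ i → A i → ℝ) (hp : ∀ i c, ∑ b, p i c b = 1)
    (θ : (i : ι) → Θ i) (f : ((i : ι) → A i) → ℝ) :
    ∑ s : (i : ι) → Θ i → A i, (∏ i, ∏ c, p i c (s i c)) * f (fun j => s j (θ j)) =
      ∑ a : (i : ι) → A i, (∏ i, p i (θ i) (a i)) * f a := by
  have hind : ∀ s : (i : ι) → Θ i → A i, f (fun j => s j (θ j)) =
      ∑ a : (i : ι) → A i, (∏ i, if s i (θ i) = a i then (1 : ℝ) else 0) * f a := by
    intro s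
    rw [Finset.sum_eq_single (fun j => s j (θ j))]
    · simp
    · intro a _ ha
      obtain ⟨j, hj⟩ := Function.ne_iff.mp ha
      rw [Finset.prod_eq_zero (Finset.mem_univ j) (if_neg fun h => hj h.symm), zero_mul]
    · simp
  simp_rw [hind, Finset.mul_sum]
  rw [Finset.sum_comm]
  refine Finset.sum_congr rfl fun a _ => ?_
  simp_rw [← mul_assoc, ← Finset.sum_mul, ← Finset.prod_mul_distrib]
  rw [sum_pi_prod fun i (g : Θ i → A i) =>
    (∏ c, p i c (g c)) * (if g (θ i) = a i then (1 : ℝ) else 0)]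
  congr 1
  exact Finset.prod_congr rfl fun i _ => sum_pi_prod_mul_ite (p i) (hp i) (θ i) (a i)

/-- Under a product distribution, the coordinate `i` can be resampled independently of the others. -/
theorem sum_pi_prod_resample
    (q : (j : ι) → A j → ℝ) (i : ι) (hq : ∑ b, q i b = 1)
    (f : ((j : ι) → A j) → ℝ) (ψ : A i → A i) :
    ∑ a : (j : ι) → A j, (∏ j, q j (a j)) * f (Function.update a i (ψ (a i))) =
      ∑ x, q i x * ∑ a : (j : ι) → A j, (∏ j, q j (a j)) * f (Function.update a i (ψ x)) := by
  have hswap : ∀ (x : A i) (a : (j : ι) → A j),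
      q i (a i) * ∏ j, q j (Function.update a i x j) = q i x * ∏ j, q j (a j) := by
    intro x a
    rw [← Finset.mul_prod_erase _ _ (Finset.mem_univ i),
      ← Finset.mul_prod_erase _ (fun j => q j (a j)) (Finset.mem_univ i),
      Finset.prod_congr rfl fun j hj => by
        rw [Function.update_of_ne (Finset.ne_of_mem_erase hj)]]
    simp only [Function.update_self]
    ring
  calc
    _ = ∑ y : A i × ((j : ι) → A j),
        q i y.1 * ((∏ j, q j (y.2 j)) * f (Function.update y.2 i (ψ (y.2 i)))) := by
      rw [Fintype.sum_prod_type]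
      simp_rw [← Finset.mul_sum]
      rw [← Finset.sum_mul, hq, one_mul]
    _ = ∑ y : A i × ((j : ι) → A j),
        q i y.1 * ((∏ j, q j (y.2 j)) * f (Function.update y.2 i (ψ y.1))) := by
      refine Finset.sum_nbij' (fun y => (y.2 i, Function.update y.2 i y.1))
        (fun y => (y.2 i, Function.update y.2 i y.1)) (by simp) (by simp) (by simp) (by simp) ?_
      intro y _
      simp only [Function.update_idem]
      rw [← mul_assoc, ← mul_assoc, hswap]
    _ = _ := by
      rw [Fintype.sum_prod_type]
      simp_rw [← Finset.mul_sum]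

/-- A sum over types weighted by the marginal and a conditional expectation is a sum over type
profiles weighted by the prior. -/
theorem sum_prior_eq_sum_marginal
    (ρ : ((i : ι) → Θ i) → ℝ) (i : ι) (hρm : ∀ θi, 0 < marginal ρ i θi)
    (w : Θ i → A i → ℝ) (E : ((j : ι) → Θ j) → A i → ℝ) (φ : Θ i → A i → A i) :
    ∑ θ, ρ θ * ∑ x, w (θ i) x * E θ (φ (θ i) x) =
      ∑ c, marginal ρ i c * ∑ x, w c x *
        ((∑ θ, if θ i = c then ρ θ * E θ (φ c x) else 0) / marginal ρ i c) := by
  have hc : ∀ c, marginal ρ i c * ∑ x, w c x *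
      ((∑ θ, if θ i = c then ρ θ * E θ (φ c x) else 0) / marginal ρ i c) =
      ∑ θ, if θ i = c then ρ θ * ∑ x, w (θ i) x * E θ (φ (θ i) x) else 0 := by
    intro c
    have h0 := (hρm c).ne'
    calc
      _ = ∑ x, ∑ θ, w c x * (if θ i = c then ρ θ * E θ (φ c x) else 0) := by
        rw [Finset.mul_sum]
        refine Finset.sum_congr rfl fun x _ => ?_
        rw [← Finset.mul_sum]
        field_simp
      _ = _ := by
        rw [Finset.sum_comm]
        refine Finset.sum_congr rfl fun θ _ => ?_
        split_ifs with h
        · rw [h, Finset.mul_sum]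
          exact Finset.sum_congr rfl fun x _ => by ring
        · simp
  simp_rw [hc]
  rw [Finset.sum_comm]
  simp

/-- The value of deviation `φ` against the empirical distribution is the average over the rounds of
the reward collected by `φ`. -/
theorem empirical_deviation_value
    (ρ : ((i : ι) → Θ i) → ℝ) (hρm : ∀ (i : ι) (θi : Θ i), 0 < marginal ρ i θi)
    (v : (i : ι) → ((j : ι) → Θ j) → ((j : ι) → A j) → ℝ) (T : ℕ)
    (πt : (i : ι) → Fin T → Θ i → A i → ℝ) (hπt : ∀ i t θi, ∑ a, πt i t θi a = 1)
    (u : (i : ι) → Fin T → Θ i → A i → ℝ)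
    (hu : ∀ (i : ι) (t : Fin T) (θi : Θ i) (ai : A i),
      u i t θi ai =
        (∑ θ : (j : ι) → Θ j, if θ i = θi then
            ρ θ * ∑ a : (j : ι) → A j,
              (∏ j, πt j t (θ j) (a j)) * v i θ (Function.update a i ai)
          else 0) / marginal ρ i θi)
    (i : ι) (φ : Θ i → A i → A i) :
    ∑ θ, ρ θ * ∑ s : (j : ι) → Θ j → A j,
        (∑ t : Fin T, ∏ i, ∏ θi, πt i t θi (s i θi)) / (T : ℝ) *
          v i θ (Function.update (fun j => s j (θ j)) i (φ (θ i) (s i (θ i)))) =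
      (∑ t, ∑ θi, marginal ρ i θi * ∑ ai, πt i t θi ai * u i t θi (φ θi ai)) / (T : ℝ) := by
  have hs : ∀ θ : (j : ι) → Θ j, ∑ s : (j : ι) → Θ j → A j,
      (∑ t : Fin T, ∏ i, ∏ θi, πt i t θi (s i θi)) / (T : ℝ) *
        v i θ (Function.update (fun j => s j (θ j)) i (φ (θ i) (s i (θ i)))) =
      (∑ t : Fin T, ∑ x, πt i t (θ i) x * ∑ a : (j : ι) → A j,
        (∏ j, πt j t (θ j) (a j)) * v i θ (Function.update a i (φ (θ i) x))) / (T : ℝ) := by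
    intro θ
    simp_rw [div_mul_eq_mul_div, ← Finset.sum_div, Finset.sum_mul]
    rw [Finset.sum_comm]
    congr 1
    refine Finset.sum_congr rfl fun t _ => ?_
    rw [sum_strategy_eval (fun i => πt i t) (fun i c => hπt i t c) θ
      fun a => v i θ (Function.update a i (φ (θ i) (a i)))]
    exact sum_pi_prod_resample (fun j => πt j t (θ j)) i (hπt i t (θ i)) (v i θ) (φ (θ i))
  simp_rw [hs, ← mul_div_assoc, ← Finset.sum_div]
  congr 1
  simp_rw [Finset.mul_sum Finset.univ (fun t : Fin T => ∑ x, _)]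
  rw [Finset.sum_comm]
  refine Finset.sum_congr rfl fun t _ => ?_
  simp_rw [hu]
  exact sum_prior_eq_sum_marginal ρ i (hρm i) (πt i t) (fun θ y => ∑ a : (j : ι) → A j,
    (∏ j, πt j t (θ j) (a j)) * v i θ (Function.update a i y)) φ

/-- The empirical distribution of no-type-wise-swap-regret dynamics is an
`(max_i R_TS,i)/T`-approximate agent-normal-form correlated equilibrium. -/
theorem dynamics_ANFCE
    (ρ : ((i : ι) → Θ i) → ℝ) (hρ : IsDist ρ)
    (hρm : ∀ (i : ι) (θi : Θ i), 0 < marginal ρ i θi)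
    (v : (i : ι) → ((j : ι) → Θ j) → ((j : ι) → A j) → ℝ)
    (hv : ∀ i θ a, v i θ a ∈ Set.Icc (0 : ℝ) 1)
    (T : ℕ) (hT : 1 ≤ T)
    (πt : (i : ι) → Fin T → Θ i → A i → ℝ)
    (hπt : ∀ i t θi, IsDist (πt i t θi))
    (u : (i : ι) → Fin T → Θ i → A i → ℝ)
    (hu : ∀ (i : ι) (t : Fin T) (θi : Θ i) (ai : A i),
      u i t θi ai =
        (∑ θ : (j : ι) → Θ j, if θ i = θi then
            ρ θ * ∑ a : (j : ι) → A j,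
              (∏ j, πt j t (θ j) (a j)) * v i θ (Function.update a i ai)
          else 0) / marginal ρ i θi) :
    IsDist (fun s : (i : ι) → Θ i → A i =>
      (∑ t : Fin T, ∏ i, ∏ θi, πt i t θi (s i θi)) / (T : ℝ)) ∧
    IsANFCE ρ v ((⨆ i : ι, typewiseSwapRegret ρ T πt u i) / (T : ℝ))
      (fun s => (∑ t : Fin T, ∏ i, ∏ θi, πt i t θi (s i θi)) / (T : ℝ)) := by
  have hT0 : (0 : ℝ) < T := by exact_mod_cast hT
  constructor
  · have hnn : ∀ s : (i : ι) → Θ i → A i,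
        0 ≤ (∑ t : Fin T, ∏ i, ∏ θi, πt i t θi (s i θi)) / (T : ℝ) := fun s =>
      div_nonneg (Finset.sum_nonneg fun t _ => Finset.prod_nonneg fun i _ =>
        Finset.prod_nonneg fun c _ => ((hπt i t c).1 _).1) hT0.le
    have hsum : ∑ s : (i : ι) → Θ i → A i,
        (∑ t : Fin T, ∏ i, ∏ θi, πt i t θi (s i θi)) / (T : ℝ) = 1 := by
      rw [← Finset.sum_div, Finset.sum_comm, div_eq_one_iff_eq hT0.ne']
      have h : ∀ t : Fin T,
          ∑ s : (i : ι) → Θ i → A i, ∏ i, ∏ θi, πt i t θi (s i θi) = 1 := by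
        intro t
        rw [sum_pi_prod fun i (g : Θ i → A i) => ∏ θi, πt i t θi (g θi)]
        simp [sum_pi_prod, (hπt _ _ _).2]
      simp [h]
    refine ⟨fun s => ⟨hnn s, ?_⟩, hsum⟩
    rw [← hsum]
    exact Finset.single_le_sum (f := fun s : (i : ι) → Θ i → A i =>
      (∑ t : Fin T, ∏ i, ∏ θi, πt i t θi (s i θi)) / (T : ℝ))
      (fun s _ => hnn s) (Finset.mem_univ s)
  · intro i φ
    have value := empirical_deviation_value ρ hρm v T πt (fun i t c => (hπt i t c).2) u hu i
    have hid := value fun _ a => a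
    simp only [Function.update_eq_self_iff.mpr] at hid
    rw [value φ, hid, ge_iff_le, sub_le_iff_le_add, ← add_div]
    refine div_le_div_of_nonneg_right ?_ hT0.le
    have h₁ : ∑ t, ∑ θi, marginal ρ i θi *
        ∑ ai, πt i t θi ai * (u i t θi (φ θi ai) - u i t θi ai) ≤
        typewiseSwapRegret ρ T πt u i :=
      le_ciSup (f := fun φ : Θ i → A i → A i => ∑ t, ∑ θi, marginal ρ i θi *
        ∑ ai, πt i t θi ai * (u i t θi (φ θi ai) - u i t θi ai))
        (Set.finite_range _).bddAbove φ
    have h₂ : typewiseSwapRegret ρ T πt u i ≤ ⨆ i : ι, typewiseSwapRegret ρ T πt u i :=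
      le_ciSup (Set.finite_range _).bddAbove i
    simp only [mul_sub, Finset.sum_sub_distrib] at h₁
    linarith
end
end

section
/- For every ε ≥ 0 and every type-wise distribution π ∈ Δ(A)^Θ, the following are equivalent: (i) π ∈ Π_ANF^ε, i.e., π = η(σ) for some ε-approximate agent-normal-form correlated equilibrium σ; (ii) π is strategy-representable and, for every i ∈ N and every φ : Θ_i × A_i → A_i, E_{θ∼ρ} E_{a∼π(θ)}[v_i(θ; a)] ≥ E_{θ∼ρ} E_{a∼π(θ)}[v_i(θ; φ(θ_i,a_i), a_{-i})] − ε. -/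
open Finset
open scoped Classical

noncomputable section

variable {ι : Type*} [Fintype ι] [Nonempty ι]
  {Θ A : ι → Type*}
  [∀ i, Fintype (Θ i)] [∀ i, Nonempty (Θ i)]
  [∀ i, Fintype (A i)] [∀ i, Nonempty (A i)]

/-- Change of variables: an expectation under `eta σ θ` is an expectation under `σ`. -/
theorem sum_eta_mul (σ : ((i : ι) → Θ i → A i) → ℝ) (θ : (i : ι) → Θ i)
    (f : ((i : ι) → A i) → ℝ) :
    ∑ a, eta σ θ a * f a = ∑ s : (i : ι) → Θ i → A i, σ s * f (fun i => s i (θ i)) := by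
  simp only [eta, Finset.sum_mul, ite_mul, zero_mul]
  rw [Finset.sum_comm]
  simp

/-- The agent-normal-form incentive constraints on `σ` are those on `eta σ`. -/
theorem isANFCE_iff_eta (ρ : ((i : ι) → Θ i) → ℝ)
    (v : (i : ι) → ((j : ι) → Θ j) → ((j : ι) → A j) → ℝ) (ε : ℝ)
    (σ : ((i : ι) → Θ i → A i) → ℝ) :
    IsANFCE ρ v ε σ ↔
      ∀ (i : ι) (φ : Θ i → A i → A i),
        ∑ θ, ρ θ * ∑ a : (j : ι) → A j, eta σ θ a * v i θ a ≥
          ∑ θ, ρ θ * ∑ a : (j : ι) → A j,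
            eta σ θ a * v i θ (Function.update a i (φ (θ i) (a i))) - ε := by
  have h (i : ι) (φ : Θ i → A i → A i) (θ : (j : ι) → Θ j) :=
    sum_eta_mul σ θ fun a => v i θ (Function.update a i (φ (θ i) (a i)))
  simp only [IsANFCE, sum_eta_mul, h]

/-- A type-wise distribution `π` lies in `Π_ANF^ε` iff it is strategy-representable and
satisfies the agent-normal-form incentive constraints on type-wise distributions. -/
theorem mem_PiANF_iff
    (ρ : ((i : ι) → Θ i) → ℝ) (hρ : IsDist ρ)
    (v : (i : ι) → ((j : ι) → Θ j) → ((j : ι) → A j) → ℝ)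
    (hv : ∀ i θ a, v i θ a ∈ Set.Icc (0 : ℝ) 1)
    (ε : ℝ) (hε : 0 ≤ ε)
    (π : ((i : ι) → Θ i) → ((i : ι) → A i) → ℝ)
    (hπ : ∀ θ, IsDist (π θ)) :
    (∃ σ : ((i : ι) → Θ i → A i) → ℝ, IsDist σ ∧ IsANFCE ρ v ε σ ∧ eta σ = π) ↔
      (StrategyRepresentable π ∧
        ∀ (i : ι) (φ : Θ i → A i → A i),
          ∑ θ, ρ θ * ∑ a : (j : ι) → A j, π θ a * v i θ a ≥
            ∑ θ, ρ θ * ∑ a : (j : ι) → A j,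
              π θ a * v i θ (Function.update a i (φ (θ i) (a i))) - ε) := by
  constructor
  · rintro ⟨σ, hσ, hce, rfl⟩
    exact ⟨⟨σ, hσ, rfl⟩, (isANFCE_iff_eta ρ v ε σ).1 hce⟩
  · rintro ⟨⟨σ, hσ, rfl⟩, hic⟩
    exact ⟨σ, hσ, (isANFCE_iff_eta ρ v ε σ).2 hic, rfl⟩
end
end

section
/- Let Θ and A be finite nonempty sets, T ≥ 1, and for each t = 1,…,T let ū^t ∈ [0,1]^{Θ×A}, x^t ∈ 𝒳, w^t_θ ∈ Δ(Θ) for each θ ∈ Θ, and y^t_{θ,θ',a'} ∈ Δ(A) for each θ,θ' ∈ Θ and a' ∈ A. Define Q^t by Q^t((θ,a),(θ',a')) = w^t_θ(θ')·y^t_{θ,θ',a'}(a) and U^t((θ,a),(θ',a')) = ū^t(θ,a)·x^t(θ',a'). Define R_{θ,θ',a'} = max_{a*∈A} ∑_{t=1}^T x^t(θ',a')·ū^t(θ,a*) − ∑_{t=1}^T ∑_{a∈A} y^t_{θ,θ',a'}(a)·x^t(θ',a')·ū^t(θ,a), and R_θ = max_{θ*∈Θ} ∑_{t=1}^T ∑_{a,a'∈A}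 y^t_{θ,θ*,a'}(a)·x^t(θ*,a')·ū^t(θ,a) − ∑_{t=1}^T ∑_{θ'∈Θ} w^t_θ(θ') ∑_{a,a'∈A} y^t_{θ,θ',a'}(a)·x^t(θ',a')·ū^t(θ,a). Then sup_{Q∈𝒬} ∑_{t=1}^T ⟨Q, U^t⟩ − ∑_{t=1}^T ⟨Q^t, U^t⟩ ≤ ∑_{θ∈Θ} R_θ + ∑_{θ∈Θ} max_{θ'∈Θ} ∑_{a'∈A} R_{θ,θ',a'}. -/
open Finset
open scoped Classical

noncomputable section

variable {Θ A : Type*} [Fintype Θ] [Nonempty Θ] [Fintype A] [Nonempty A]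

/-- The set `𝒳` of type-wise action distributions, as vectors. -/
def XSet (Θ A : Type*) [Fintype A] : Set (Θ × A → ℝ) :=
  {x | (∀ p, x p ∈ Set.Icc (0 : ℝ) 1) ∧ ∀ θ, ∑ a, x (θ, a) = 1}

/-- The set `𝒬` of transformations. -/
def QSet (Θ A : Type*) [Fintype Θ] [Fintype A] : Set (Θ × A → Θ × A → ℝ) :=
  {Q | (∀ p q, Q p q ∈ Set.Icc (0 : ℝ) 1) ∧
    ∃ W : Θ → Θ → ℝ, (∀ θ θ', W θ θ' ∈ Set.Icc (0 : ℝ) 1) ∧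
      (∀ θ, ∑ θ', W θ θ' = 1) ∧
      ∀ θ θ' a', ∑ a, Q (θ, a) (θ', a') = W θ θ'}

/-- Regret of the subroutine `𝔈_{θ,θ',a'}`. -/
def subRegretA (T : ℕ) (ubar : Fin T → Θ × A → ℝ) (x : Fin T → Θ × A → ℝ)
    (y : Fin T → Θ → Θ → A → A → ℝ) (θ θ' : Θ) (a' : A) : ℝ :=
  (⨆ astar : A, ∑ t, x t (θ', a') * ubar t (θ, astar)) -
    ∑ t, ∑ a, y t θ θ' a' a * (x t (θ', a') * ubar t (θ, a))

/-- Regret of the subroutine `𝔈_θ`. -/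
def subRegretT (T : ℕ) (ubar : Fin T → Θ × A → ℝ) (x : Fin T → Θ × A → ℝ)
    (w : Fin T → Θ → Θ → ℝ) (y : Fin T → Θ → Θ → A → A → ℝ) (θ : Θ) : ℝ :=
  (⨆ θstar : Θ, ∑ t, ∑ a, ∑ a', y t θ θstar a' a * (x t (θstar, a') * ubar t (θ, a))) -
    ∑ t, ∑ θ', w t θ θ' * ∑ a, ∑ a', y t θ θ' a' a * (x t (θ', a') * ubar t (θ, a))

lemma sum_mul_le_ciSup {X : Type*} [Fintype X] {f g : X → ℝ} (hf : ∀ x, 0 ≤ f x)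
    {s : ℝ} (hs : ∑ x, f x = s) : ∑ x, f x * g x ≤ s * ⨆ x, g x := by
  rw [← hs, Finset.sum_mul]
  exact Finset.sum_le_sum fun i _ =>
    mul_le_mul_of_nonneg_left (le_ciSup (Set.finite_range g).bddAbove i) (hf i)

lemma stochastic_product_mem_QSet {Θ A : Type*} [Fintype Θ] [Fintype A]
    {w : Θ → Θ → ℝ} (hw : ∀ θ, IsDist (w θ))
    {y : Θ → Θ → A → A → ℝ} (hy : ∀ θ θ' a', IsDist (y θ θ' a')) :
    (fun p q : Θ × A => w p.1 q.1 * y p.1 q.1 q.2 p.2) ∈ QSet Θ A := by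
  refine ⟨fun p q => ?_, w, fun θ => (hw θ).1, fun θ => (hw θ).2, fun θ θ' a' => ?_⟩
  · obtain ⟨h0, h1⟩ := (hw p.1).1 q.1
    obtain ⟨k0, k1⟩ := (hy p.1 q.1 q.2).1 p.2
    exact ⟨mul_nonneg h0 k0, mul_le_one₀ h1 k0 k1⟩
  · simp only [← Finset.mul_sum, (hy θ θ' a').2, mul_one]

/-- The pairing of `Q` with `∑ t, U^t`, with the sums over types pulled outside. -/
lemma sum_pairing_eq {Θ A : Type*} [Fintype Θ] [Fintype A] {T : ℕ}
    (Q : Fin T → Θ × A → Θ × A → ℝ) (u x : Fin T → Θ × A → ℝ) :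
    ∑ t, ∑ p : Θ × A, ∑ q : Θ × A, Q t p q * (u t p * x t q) =
      ∑ θ, ∑ θ', ∑ a', ∑ t, ∑ a, Q t (θ, a) (θ', a') * (x t (θ', a') * u t (θ, a)) := by
  simp only [Fintype.sum_prod_type, mul_comm (u _ _)]
  rw [Finset.sum_comm]
  refine Finset.sum_congr rfl fun θ _ => ?_
  calc _ = ∑ t, ∑ θ', ∑ a', ∑ a, Q t (θ, a) (θ', a') * (x t (θ', a') * u t (θ, a)) := by
        refine Finset.sum_congr rfl fun t _ => ?_
        rw [Finset.sum_comm]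
        exact Finset.sum_congr rfl fun θ' _ => Finset.sum_comm
    _ = _ := by
        rw [Finset.sum_comm]
        exact Finset.sum_congr rfl fun θ' _ => Finset.sum_comm

/-- For a fixed type `θ`, the value of a transformation with type marginals `W` is bounded by the
best responses of the subroutines for `θ`. -/
lemma type_value_le {Θ A : Type*} [Fintype Θ] [Fintype A] {T : ℕ}
    (ubar x : Fin T → Θ × A → ℝ) (y : Fin T → Θ → Θ → A → A → ℝ)
    {Q : Θ × A → Θ × A → ℝ} (hQ : ∀ p q, 0 ≤ Q p q) {W : Θ → Θ → ℝ}
    (hW : ∀ θ θ', 0 ≤ W θ θ') (hW1 : ∀ θ, ∑ θ', W θ θ' = 1)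
    (hQW : ∀ θ θ' a', ∑ a, Q (θ, a) (θ', a') = W θ θ') (θ : Θ) :
    ∑ θ', ∑ a', ∑ t, ∑ a, Q (θ, a) (θ', a') * (x t (θ', a') * ubar t (θ, a)) ≤
      (⨆ θ', ∑ t, ∑ a, ∑ a', y t θ θ' a' a * (x t (θ', a') * ubar t (θ, a))) +
        ⨆ θ', ∑ a', subRegretA T ubar x y θ θ' a' := by
  have hbest : ∀ θ' a', ∑ t, ∑ a, Q (θ, a) (θ', a') * (x t (θ', a') * ubar t (θ, a)) ≤
      W θ θ' * ⨆ a, ∑ t, x t (θ', a') * ubar t (θ, a) := by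
    intro θ' a'
    rw [Finset.sum_comm]
    simp only [← Finset.mul_sum]
    exact sum_mul_le_ciSup (fun a => hQ _ _) (hQW θ θ' a')
  have hsplit : ∀ θ', ∑ a', (⨆ a, ∑ t, x t (θ', a') * ubar t (θ, a)) =
      (∑ t, ∑ a, ∑ a', y t θ θ' a' a * (x t (θ', a') * ubar t (θ, a))) +
        ∑ a', subRegretA T ubar x y θ θ' a' := by
    intro θ'
    have hswap : ∑ t, ∑ a, ∑ a', y t θ θ' a' a * (x t (θ', a') * ubar t (θ, a)) =
        ∑ a', ∑ t, ∑ a, y t θ θ' a' a * (x t (θ', a') * ubar t (θ, a)) := by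
      rw [Finset.sum_comm (s := (univ : Finset A))]
      exact Finset.sum_congr rfl fun t _ => Finset.sum_comm
    simp only [hswap, subRegretA, Finset.sum_sub_distrib]
    ring
  calc _ ≤ ∑ θ', W θ θ' * ∑ a', ⨆ a, ∑ t, x t (θ', a') * ubar t (θ, a) := by
        simp only [Finset.mul_sum (s := (univ : Finset A))]
        exact Finset.sum_le_sum fun θ' _ => Finset.sum_le_sum fun a' _ => hbest θ' a'
    _ = (∑ θ', W θ θ' * ∑ t, ∑ a, ∑ a', y t θ θ' a' a * (x t (θ', a') * ubar t (θ, a))) +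
          ∑ θ', W θ θ' * ∑ a', subRegretA T ubar x y θ θ' a' := by
        simp only [hsplit, mul_add, Finset.sum_add_distrib]
    _ ≤ _ := by
        refine add_le_add ?_ ?_
        · simpa only [one_mul] using sum_mul_le_ciSup (hW θ) (hW1 θ)
        · simpa only [one_mul] using sum_mul_le_ciSup (hW θ) (hW1 θ)

/-- The external regret of online linear optimization over `𝒬` is bounded by the sum of the
external regrets of the small subroutines. -/
theorem linear_regret_decomposition
    (T : ℕ) (hT : 1 ≤ T)
    (ubar : Fin T → Θ × A → ℝ) (hubar : ∀ t p, ubar t p ∈ Set.Icc (0 : ℝ) 1)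
    (x : Fin T → Θ × A → ℝ) (hx : ∀ t, x t ∈ XSet Θ A)
    (w : Fin T → Θ → Θ → ℝ) (hw : ∀ t θ, IsDist (w t θ))
    (y : Fin T → Θ → Θ → A → A → ℝ) (hy : ∀ t θ θ' a', IsDist (y t θ θ' a')) :
    (⨆ Q : QSet Θ A,
        ∑ t, ∑ p : Θ × A, ∑ q : Θ × A, Q.1 p q * (ubar t p * x t q)) -
      ∑ t, ∑ p : Θ × A, ∑ q : Θ × A,
        (w t p.1 q.1 * y t p.1 q.1 q.2 p.2) * (ubar t p * x t q) ≤
    (∑ θ, subRegretT T ubar x w y θ) +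
      ∑ θ, ⨆ θ' : Θ, ∑ a', subRegretA T ubar x y θ θ' a' := by
  have : Nonempty (QSet Θ A) :=
    ⟨⟨_, stochastic_product_mem_QSet (hw ⟨0, hT⟩) (hy ⟨0, hT⟩)⟩⟩
  have hplayed : ∑ t, ∑ p : Θ × A, ∑ q : Θ × A,
      (w t p.1 q.1 * y t p.1 q.1 q.2 p.2) * (ubar t p * x t q) =
      ∑ θ, ∑ t, ∑ θ', w t θ θ' *
        ∑ a, ∑ a', y t θ θ' a' a * (x t (θ', a') * ubar t (θ, a)) := by
    rw [Finset.sum_comm (t := (univ : Finset (Fin T)))]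
    refine Finset.sum_congr rfl fun t _ => ?_
    simp only [Fintype.sum_prod_type, Finset.mul_sum]
    refine Finset.sum_congr rfl fun θ _ => ?_
    rw [Finset.sum_comm]
    refine Finset.sum_congr rfl fun θ' _ => Finset.sum_congr rfl fun a _ =>
      Finset.sum_congr rfl fun a' _ => ?_
    ring
  rw [hplayed]
  simp only [subRegretT, Finset.sum_sub_distrib]
  rw [sub_add_eq_add_sub]
  refine sub_le_sub_right (ciSup_le ?_) _
  rintro ⟨Q, hQ, W, hW, hW1, hQW⟩
  rw [sum_pairing_eq (fun _ => Q), ← Finset.sum_add_distrib]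
  exact Finset.sum_le_sum fun θ _ => type_value_le ubar x y (fun p q => (hQ p q).1)
    (fun θ θ' => (hW θ θ').1) hW1 hQW θ
end
end
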